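/- L² extension across a divisor (Riemann extension with L² bound): let f be a holomorphic function on the punctured polydisc D^n \ {z₁⋯z_d = 0} which is square-integrable with respect to Lebesgue measure on D^n. Then f extends to a holomorphic function on all of D^n. -/

import Mathlib

open MeasureTheory

namespace L2Ext

open Metric Set Filter Topology

theorem paramCircle {E : Type*} [NormedAddCommGroup E] [NormedSpace ℂ E] [FiniteDimensional ℂ E]
    [MeasurableSpace E] [BorelSpace E]
    (G : ℂ × E → ℂ) (W : Set (ℂ × E)) (hW : IsOpen W) (hG : DifferentiableOn ℂ G W)
    (R : ℝ) (x₀ : E) (hK : sphere (0:ℂ) |R| ×ˢ {x₀} ⊆ W) :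
    DifferentiableAt ℂ (fun x => ∮ w in C(0, R), G (w, x)) x₀ := by
  have : ProperSpace E := FiniteDimensional.proper ℂ E
  have hKc : IsCompact (sphere (0:ℂ) |R| ×ˢ {x₀}) := (isCompact_sphere _ _).prod isCompact_singleton
  obtain ⟨δ, hδ, hδW⟩ := hKc.exists_cthickening_subset_open hW hK
  have hTc : IsCompact (cthickening δ (sphere (0:ℂ) |R| ×ˢ {x₀})) := hKc.cthickening
  obtain ⟨M, hM⟩ := hTc.exists_bound_of_continuousOn (hG.continuousOn.mono hδW)
  have hmem : ∀ θ : ℝ, ∀ x ∈ ball x₀ (δ/2), ∀ p ∈ ball (circleMap 0 R θ, x) (δ/2),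
      p ∈ cthickening δ (sphere (0:ℂ) |R| ×ˢ {x₀}) := by
    intro θ x hx p hp
    refine mem_cthickening_of_dist_le p (circleMap 0 R θ, x₀) δ _ ⟨circleMap_mem_sphere' _ _ _, rfl⟩ ?_
    have h1 : dist ((circleMap 0 R θ, x) : ℂ × E) (circleMap 0 R θ, x₀) < δ/2 := by
      rw [Prod.dist_eq]; simpa [hδ] using hx
    have := dist_triangle p (circleMap 0 R θ, x) (circleMap 0 R θ, x₀)
    have := mem_ball.1 hp
    linarith
  have hself : ∀ θ : ℝ, ∀ x ∈ ball x₀ (δ/2), (circleMap 0 R θ, x) ∈ W := fun θ x hx =>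
    hδW (hmem θ x hx _ (mem_ball_self (by linarith)))
  have hdc : Continuous (deriv (circleMap 0 R)) := by
    rw [show deriv (circleMap 0 R) = _ from funext (deriv_circleMap 0 R)]
    fun_prop
  have hcont : ∀ x ∈ ball x₀ (δ/2), Continuous (fun θ : ℝ => deriv (circleMap 0 R) θ • G (circleMap 0 R θ, x)) := by
    intro x hx
    refine Continuous.smul hdc ?_
    exact hG.continuousOn.comp_continuous (by fun_prop) (fun θ => hself θ x hx)
  have key := intervalIntegral.hasFDerivAt_integral_of_dominated_of_fderiv_le (𝕜 := ℂ) (μ := volume)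
    (a := 0) (b := 2 * Real.pi) (x₀ := x₀) (s := ball x₀ (δ/2))
    (F := fun x θ => deriv (circleMap 0 R) θ • G (circleMap 0 R θ, x))
    (F' := fun x θ => deriv (circleMap 0 R) θ •
      (fderiv ℂ G (circleMap 0 R θ, x)).comp (ContinuousLinearMap.inr ℂ ℂ E))
    (bound := fun θ => |R| * (2 * M / (δ/2)))
    (ball_mem_nhds _ (by linarith)) ?_ ?_ ?_ ?_ ?_ ?_
  · exact key.differentiableAt
  · filter_upwards [ball_mem_nhds x₀ (half_pos hδ)] with x hx
    exact (hcont x hx).aestronglyMeasurable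
  · exact (hcont x₀ (mem_ball_self (half_pos hδ))).intervalIntegrable _ _
  · refine AEStronglyMeasurable.smul (hdc.aestronglyMeasurable) ?_
    have h1 : Measurable (fderiv ℂ G) := measurable_fderiv ℂ G
    have h2 : Measurable (fun θ : ℝ => ((circleMap 0 R θ, x₀) : ℂ × E)) := by fun_prop
    have h3 : Continuous (fun L : (ℂ × E) →L[ℂ] ℂ => L.comp (ContinuousLinearMap.inr ℂ ℂ E)) := by fun_prop
    exact h3.comp_aestronglyMeasurable (h1.comp h2).stronglyMeasurable.aestronglyMeasurable
  · refine ae_of_all _ fun θ _ x hx => ?_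
    rw [norm_smul]
    have h0 : ‖deriv (circleMap 0 R) θ‖ = |R| := by simp [deriv_circleMap]
    rw [h0]
    gcongr
    have h1 : ‖fderiv ℂ G (circleMap 0 R θ, x)‖ ≤ 2 * M / (δ/2) := by
      refine Complex.norm_fderiv_le_div_of_mapsTo_ball
        (hG.mono fun p hp => hδW (hmem θ x hx p hp)) ?_ (half_pos hδ)
      intro p hp
      rw [mem_closedBall, dist_eq_norm]
      have a1 := hM p (hmem θ x hx p hp)
      have a2 := hM _ (hmem θ x hx _ (mem_ball_self (half_pos hδ)))
      linarith [norm_sub_le (G p) (G (circleMap 0 R θ, x))]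
    calc _ ≤ ‖fderiv ℂ G (circleMap 0 R θ, x)‖ * ‖ContinuousLinearMap.inr ℂ ℂ E‖ :=
          ContinuousLinearMap.opNorm_comp_le _ _
      _ ≤ ‖fderiv ℂ G (circleMap 0 R θ, x)‖ * 1 := by
          gcongr; exact ContinuousLinearMap.norm_inr_le_one ..
      _ ≤ _ := by simpa using h1
  · exact intervalIntegrable_const
  · refine ae_of_all _ fun θ _ x hx => ?_
    have h1 := ((hG _ (hself θ x hx)).differentiableAt (hW.mem_nhds (hself θ x hx))).hasFDerivAt
    exact (h1.comp x (hasFDerivAt_prodMk_right _ _)).const_smul (deriv (circleMap 0 R) θ)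

theorem polyMean {n : ℕ} (g : (Fin n → ℂ) → ℂ) (z : Fin n → ℂ) (r : Fin n → ℝ)
    (hr : ∀ k, 0 < r k)
    (hg : ∀ u, (∀ k, ‖u k - z k‖ ≤ r k) → DifferentiableAt ℂ g u) :
    ‖g z‖ ^ 2 * ∏ k, (Real.pi * r k ^ 2) ≤
      ∫ u in univ.pi (fun k => closedBall (z k) (r k)), ‖g u‖ ^ 2 := by
  set K : Set (Fin n → ℂ) := univ.pi (fun k => closedBall (0:ℂ) (r k)) with hKdef
  have hKc : IsCompact K := isCompact_univ_pi fun k => isCompact_closedBall _ _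
  have hKm : MeasurableSet K := hKc.measurableSet
  have hvol : volume.real K = ∏ k, (Real.pi * r k ^ 2) := by
    rw [Measure.real, hKdef, volume_pi_pi, ENNReal.toReal_prod]
    refine Finset.prod_congr rfl fun k _ => ?_
    rw [Complex.volume_closedBall]
    simp [(hr k).le, mul_comm]
  -- translation
  have htr : ∀ h : (Fin n → ℂ) → ℝ, ∫ u in univ.pi (fun k => closedBall (z k) (r k)), h u =
      ∫ u in K, h (z + u) := by
    intro h
    have hmp : MeasurePreserving (fun u : Fin n → ℂ => z + u) volume volume :=
      measurePreserving_add_left volume z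
    rw [← hmp.setIntegral_preimage_emb (measurableEmbedding_addLeft z)]
    congr 2
    ext u
    simp [hKdef, Set.mem_pi, dist_eq_norm]
  rw [htr]
  have hKmem : ∀ u, u ∈ K ↔ ∀ k, ‖u k‖ ≤ r k := by
    intro u; simp [hKdef, Set.mem_pi]
  have hgd : ∀ u ∈ K, ∀ c : ℂ, ‖c‖ ≤ 1 → DifferentiableAt ℂ g (z + c • u) := by
    intro u hu c hc
    refine hg _ fun k => ?_
    simp only [Pi.add_apply, Pi.smul_apply, add_sub_cancel_left, norm_smul]
    have := (hKmem u).1 hu k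
    nlinarith [norm_nonneg (u k), norm_nonneg c]
  -- rotation
  have hrot : ∀ c : ℂ, ‖c‖ = 1 → ∫ u in K, g (z + c • u) ^ 2 = ∫ u in K, g (z + u) ^ 2 := by
    intro c hc
    let cc : Circle := ⟨c, by simpa [Submonoid.unitSphere] using hc⟩
    have hmp : MeasurePreserving (fun u : Fin n → ℂ => c • u) volume volume := by
      exact volume_preserving_pi (fun _ => (rotation cc).measurePreserving)
    have hc0 : c ≠ 0 := by rintro rfl; simp at hc
    have hemb : MeasurableEmbedding (fun u : Fin n → ℂ => c • u) :=
      (MeasurableEquiv.smul₀ c hc0).measurableEmbedding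
    rw [← hmp.setIntegral_preimage_emb hemb (fun u => g (z + u) ^ 2) K]
    congr 2
    ext u
    simp [hKmem, hc]
  -- mean value in the slice
  have hmv : ∀ u ∈ K, ∫ θ in (0:ℝ)..2 * Real.pi, g (z + circleMap 0 1 θ • u) ^ 2
      = (2 * Real.pi) * g z ^ 2 := by
    intro u hu
    have hd : DifferentiableOn ℂ (fun c : ℂ => g (z + c • u) ^ 2) (closedBall 0 1) := by
      intro c hc
      have h1 := hgd u hu c (by simpa using hc)
      exact ((h1.comp c (by fun_prop : DifferentiableAt ℂ (fun c : ℂ => z + c • u) c)).pow 2).differentiableWithinAt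
    have h := DiffContOnCl.circleAverage (c := 0) (R := 1) (f := fun c : ℂ => g (z + c • u) ^ 2)
      (by
        rw [abs_one]
        refine DifferentiableOn.diffContOnCl ?_
        rwa [closure_ball _ one_ne_zero])
    rw [Real.circleAverage_def] at h
    simp only [zero_smul, add_zero] at h
    rw [← h]
    simp only [Complex.real_smul]
    push_cast
    field_simp
  have hint : IntegrableOn (Function.uncurry fun (θ : ℝ) u => g (z + circleMap 0 1 θ • u) ^ 2)
      (Icc 0 (2 * Real.pi) ×ˢ K) (volume.prod volume) := by
    refine ContinuousOn.integrableOn_compact (isCompact_Icc.prod hKc) ?_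
    rintro ⟨θ, u⟩ ⟨_, hu⟩
    have h1 := (hgd u hu (circleMap 0 1 θ) (by simp)).continuousAt
    refine (ContinuousAt.pow ?_ 2).continuousWithinAt
    exact ContinuousAt.comp (f := fun p : ℝ × (Fin n → ℂ) => z + circleMap 0 1 p.1 • p.2)
      (x := (θ, u)) h1 (by fun_prop)
  have hswap : ∫ θ in (0:ℝ)..2 * Real.pi, ∫ u in K, g (z + circleMap 0 1 θ • u) ^ 2 =
      ∫ u in K, ∫ θ in (0:ℝ)..2 * Real.pi, g (z + circleMap 0 1 θ • u) ^ 2 := by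
    refine intervalIntegral_integral_swap ?_
    rw [Measure.prod_restrict]
    refine hint.mono_set (prod_mono ?_ subset_rfl)
    rw [uIoc_of_le Real.two_pi_pos.le]
    exact Ioc_subset_Icc_self
  rw [setIntegral_congr_fun hKm hmv] at hswap
  simp_rw [hrot _ (by simp : ‖circleMap 0 1 _‖ = 1)] at hswap
  rw [intervalIntegral.integral_const, setIntegral_const, hvol, sub_zero, Complex.real_smul, Complex.real_smul] at hswap
  have hfin : ∫ u in K, g (z + u) ^ 2 = ((∏ k, (Real.pi * r k ^ 2) : ℝ) : ℂ) * g z ^ 2 := by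
    have h2 : ((2 * Real.pi : ℝ) : ℂ) ≠ 0 := by exact_mod_cast Real.two_pi_pos.ne'
    apply mul_left_cancel₀ h2
    rw [hswap]; push_cast; ring
  have := norm_integral_le_integral_norm (μ := volume.restrict K) (fun u => g (z + u) ^ 2)
  rw [hfin] at this
  have hpos : 0 ≤ ∏ k, (Real.pi * r k ^ 2) := Finset.prod_nonneg fun k _ => by positivity
  simp only [norm_mul, norm_pow, Complex.norm_real, Real.norm_of_nonneg hpos] at this
  linarith

/-- punctured polydisc -/
def puncPoly {n : ℕ} (S : Finset (Fin n)) : Set (Fin n → ℂ) :=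
  {z | (∀ k, ‖z k‖ < 1) ∧ ∀ k ∈ S, z k ≠ 0}

theorem isOpen_puncPoly {n : ℕ} (S : Finset (Fin n)) : IsOpen (puncPoly S) := by
  have : puncPoly S = (⋂ k, {z : Fin n → ℂ | ‖z k‖ < 1}) ∩ ⋂ k ∈ S, {z : Fin n → ℂ | z k ≠ 0} := by
    ext z; simp [puncPoly]
  rw [this]
  refine (isOpen_iInter_of_finite fun k => isOpen_lt (by fun_prop) (by fun_prop)).inter ?_
  exact isOpen_biInter_finset fun k _ => isOpen_ne_fun (by fun_prop) (by fun_prop)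

theorem slice_tendsto {n : ℕ} (S : Finset (Fin n)) (j : Fin n)
    (f : (Fin n → ℂ) → ℂ)
    (hf : DifferentiableOn ℂ f (puncPoly (insert j S)))
    (hL2 : IntegrableOn (fun z => ‖f z‖ ^ 2) (puncPoly (insert j S)) volume)
    (z : Fin n → ℂ) (hz : z ∈ puncPoly S) :
    Tendsto (fun w : ℂ => w * f (Function.update z j w)) (𝓝[≠] 0) (𝓝 0) := by
  have hopen := isOpen_puncPoly (insert j S)
  have hex : ∀ k, ∃ r : ℝ, 0 < r ∧ ∀ u : ℂ, ‖u - z k‖ ≤ r → ‖u‖ < 1 ∧ (k ∈ S → u ≠ 0) := by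
    intro k
    have h1 : {u : ℂ | ‖u‖ < 1 ∧ (k ∈ S → u ≠ 0)} ∈ 𝓝 (z k) := by
      have a : ∀ᶠ u : ℂ in 𝓝 (z k), ‖u‖ < 1 :=
        (isOpen_lt continuous_norm continuous_const).mem_nhds (hz.1 k)
      by_cases hk : k ∈ S
      · filter_upwards [a, isOpen_ne.mem_nhds (hz.2 k hk)] with u h h' using ⟨h, fun _ => h'⟩
      · filter_upwards [a] with u h using ⟨h, fun h' => absurd h' hk⟩
    obtain ⟨r, hr, hsub⟩ := Metric.nhds_basis_closedBall.mem_iff.1 h1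
    exact ⟨r, hr, fun u hu => hsub (by simpa [dist_eq_norm] using hu)⟩
  choose r hr hrs using hex
  let R : ℂ → Fin n → ℝ := fun w => Function.update r j (‖w‖ / 2)
  let K : ℂ → Set (Fin n → ℂ) := fun w =>
    univ.pi fun k => closedBall (Function.update z j w k) (R w k)
  let C : ℝ := ∏ k ∈ Finset.univ.erase j, (Real.pi * r k ^ 2)
  have hC : 0 < C := Finset.prod_pos fun k _ => by have := hr k; positivity
  have hprod : ∀ w, ∏ k, (Real.pi * R w k ^ 2) = Real.pi / 4 * ‖w‖ ^ 2 * C := by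
    intro w
    rw [← Finset.mul_prod_erase _ _ (Finset.mem_univ j)]
    have : ∏ k ∈ Finset.univ.erase j, (Real.pi * R w k ^ 2) = C := by
      refine Finset.prod_congr rfl fun k hk => ?_
      simp [R, Function.update_of_ne (Finset.ne_of_mem_erase hk)]
    rw [this]; simp only [R, Function.update_self]; ring
  have hRnn : ∀ w k, 0 ≤ R w k := by
    intro w k
    by_cases h : k = j
    · subst h; simp only [R, Function.update_self]; positivity
    · simpa [R, h] using (hr k).le
  have hvol : ∀ w, volume (K w) = ENNReal.ofReal (Real.pi / 4 * ‖w‖ ^ 2 * C) := by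
    intro w
    rw [← hprod, volume_pi_pi, ENNReal.ofReal_prod_of_nonneg (fun k _ => by positivity)]
    refine Finset.prod_congr rfl fun k _ => ?_
    rw [Complex.volume_closedBall, mul_comm, ENNReal.ofReal_mul Real.pi_pos.le,
      ENNReal.ofReal_pow (hRnn w k)]
    congr 1
    rw [← NNReal.coe_real_pi, ENNReal.ofReal_coe_nnreal]
  have hvol0 : Tendsto (fun w => volume (K w)) (𝓝[≠] 0) (𝓝 0) := by
    simp_rw [hvol]
    have : Continuous fun w : ℂ => ENNReal.ofReal (Real.pi / 4 * ‖w‖ ^ 2 * C) := ENNReal.continuous_ofReal.comp (by fun_prop)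
    have h := (this.tendsto 0).mono_left (nhdsWithin_le_nhds (s := {0}ᶜ))
    simpa using h
  have hKsub : ∀ w : ℂ, w ≠ 0 → ‖w‖ < 1/2 → ∀ u, (∀ k, ‖u k - Function.update z j w k‖ ≤ R w k) →
      u ∈ puncPoly (insert j S) := by
    intro w hw hw2 u hu
    have hj := hu j
    simp only [R, Function.update_self] at hj
    have hwpos : 0 < ‖w‖ := norm_pos_iff.2 hw
    have hk : ∀ k, k ≠ j → ‖u k‖ < 1 ∧ (k ∈ S → u k ≠ 0) := by
      intro k hk
      have := hu k
      simp only [R, Function.update_of_ne hk] at this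
      exact hrs k _ this
    refine ⟨fun k => ?_, fun k hkS => ?_⟩
    · by_cases h : k = j
      · subst h
        have := norm_le_norm_add_norm_sub w (u k)
        rw [norm_sub_rev] at this
        linarith
      · exact (hk k h).1
    · by_cases h : k = j
      · subst h
        intro h0
        rw [h0, zero_sub, norm_neg] at hj
        linarith
      · exact (hk k h).2 ((Finset.mem_insert.1 hkS).resolve_left h)
  have hI0 : Tendsto (fun w => ∫ u in K w, ‖f u‖ ^ 2 ∂(volume.restrict (puncPoly (insert j S))))
      (𝓝[≠] 0) (𝓝 0) := by
    refine Integrable.tendsto_setIntegral_nhds_zero hL2 ?_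
    refine tendsto_of_tendsto_of_tendsto_of_le_of_le tendsto_const_nhds hvol0
      (fun _ => zero_le) fun w => ?_
    exact Measure.restrict_apply_le _ _
  have hev : ∀ᶠ w : ℂ in 𝓝[≠] 0, w ≠ 0 ∧ ‖w‖ < 1/2 := by
    refine (eventually_mem_nhdsWithin (s := {(0:ℂ)}ᶜ)).and (nhdsWithin_le_nhds ?_)
    filter_upwards [ball_mem_nhds (0:ℂ) (by norm_num : (0:ℝ) < 1/2)] with w hw
    simpa using hw
  have hbound : ∀ᶠ w : ℂ in 𝓝[≠] 0, ‖w * f (Function.update z j w)‖ ^ 2 ≤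
      (∫ u in K w, ‖f u‖ ^ 2 ∂(volume.restrict (puncPoly (insert j S)))) / (Real.pi / 4 * C) := by
    filter_upwards [hev] with w hw
    have hwpos : 0 < ‖w‖ := norm_pos_iff.2 hw.1
    have hKs : K w ⊆ puncPoly (insert j S) := fun u hu =>
      hKsub w hw.1 hw.2 u fun k => by simpa [dist_eq_norm] using hu k (mem_univ k)
    have hKm : MeasurableSet (K w) :=
      (isCompact_univ_pi fun k => isCompact_closedBall _ _).measurableSet
    rw [Measure.restrict_restrict hKm, inter_eq_left.2 hKs, le_div_iff₀ (by positivity)]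
    have h := polyMean f (Function.update z j w) (R w) (fun k => by
        by_cases h : k = j
        · subst h; simpa [R] using hw.1
        · simpa [R, h] using hr k)
      (fun u hu => (hf u (hKsub w hw.1 hw.2 u hu)).differentiableAt
        (hopen.mem_nhds (hKsub w hw.1 hw.2 u hu)))
    rw [hprod] at h
    refine le_trans (le_of_eq ?_) h
    rw [norm_mul]; ring
  have hsq : Tendsto (fun w : ℂ => ‖w * f (Function.update z j w)‖ ^ 2) (𝓝[≠] 0) (𝓝 0) := by
    refine squeeze_zero' (Eventually.of_forall fun w => by positivity) hbound ?_
    simpa using hI0.div_const (Real.pi / 4 * C)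
  rw [tendsto_zero_iff_norm_tendsto_zero]
  have := hsq.sqrt
  rw [Real.sqrt_zero] at this
  exact this.congr fun w => Real.sqrt_sq (norm_nonneg _)

theorem stepExt {n : ℕ} (S : Finset (Fin n)) (j : Fin n)
    (f : (Fin n → ℂ) → ℂ)
    (hf : DifferentiableOn ℂ f (puncPoly (insert j S)))
    (hL2 : IntegrableOn (fun z => ‖f z‖ ^ 2) (puncPoly (insert j S)) volume) :
    ∃ F : (Fin n → ℂ) → ℂ, DifferentiableOn ℂ F (puncPoly S) ∧
      EqOn F f (puncPoly (insert j S)) ∧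
      IntegrableOn (fun z => ‖F z‖ ^ 2) (puncPoly S) volume := by
  have hopen := isOpen_puncPoly (insert j S)
  have hopenS := isOpen_puncPoly S
  have hupd : ∀ z ∈ puncPoly S, ∀ w : ℂ, w ≠ 0 → ‖w‖ < 1 →
      Function.update z j w ∈ puncPoly (insert j S) := by
    intro z hz w hw hw1
    refine ⟨fun k => ?_, fun k hk => ?_⟩
    · by_cases h : k = j
      · subst h; simpa using hw1
      · simpa [h] using hz.1 k
    · by_cases h : k = j
      · subst h; simpa using hw
      · simpa [h] using hz.2 k ((Finset.mem_insert.1 hk).resolve_left h)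
  let G : (Fin n → ℂ) → ℂ := fun z => (2 * Real.pi * Complex.I : ℂ)⁻¹ •
    ∮ w in C(0, 1/2), (w - z j)⁻¹ • f (Function.update z j w)
  have hGf : ∀ z ∈ puncPoly S, z j ≠ 0 → ‖z j‖ < 1/2 → G z = f z := by
    intro z hz hzj hzj2
    set φ : ℂ → ℂ := fun w => f (Function.update z j w) with hφ
    have hφd : DifferentiableOn ℂ φ (ball 0 1 \ {0}) := by
      intro w hw
      have hm := hupd z hz w hw.2 (by simpa using hw.1)
      have h1 := (hf _ hm).differentiableAt (hopen.mem_nhds hm)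
      exact (h1.comp w (hasDerivAt_update z j w).differentiableAt).differentiableWithinAt
    have ht := slice_tendsto S j f hf hL2 z hz
    have ho : (fun w => φ w - φ 0) =o[𝓝[≠] 0] fun w => (w - 0)⁻¹ := by
      rw [Asymptotics.isLittleO_iff_tendsto']
      · have h2 : Tendsto (fun w : ℂ => w * φ 0) (𝓝[≠] 0) (𝓝 0) := by
          have : Continuous fun w : ℂ => w * φ 0 := by fun_prop
          simpa using (this.tendsto 0).mono_left (nhdsWithin_le_nhds (s := {0}ᶜ))
        have h3 := ht.sub h2
        rw [sub_zero] at h3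
        refine h3.congr fun w => ?_
        simp only [sub_zero, div_inv_eq_mul, hφ]; ring
      · filter_upwards [eventually_mem_nhdsWithin (s := {(0:ℂ)}ᶜ)] with w hw h0
        simp at h0 hw
        exact absurd h0 hw
    have hψ := Complex.differentiableOn_update_limUnder_of_isLittleO
      (ball_mem_nhds (0:ℂ) one_pos) hφd ho
    set ψ := Function.update φ 0 (limUnder (𝓝[≠] 0) φ) with hψdef
    have hcl : closedBall (0:ℂ) (1/2) ⊆ ball 0 1 := closedBall_subset_ball (by norm_num)
    have hcauchy := (hψ.diffContOnCl_ball hcl).two_pi_i_inv_smul_circleIntegral_sub_inv_smul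
      (w := z j) (by simpa using hzj2)
    have e1 : ψ (z j) = f z := by
      rw [hψdef, Function.update_of_ne hzj, hφ]; simp
    rw [← e1, ← hcauchy]
    simp only [G]
    congr 1
    refine circleIntegral.integral_congr (by norm_num) fun w hw => ?_
    have hw0 : w ≠ 0 := by rintro rfl; norm_num at hw
    simp only [hψdef, Function.update_of_ne hw0, hφ]
  have hGd : ∀ z ∈ puncPoly S, ‖z j‖ < 1/2 → DifferentiableAt ℂ G z := by
    intro z hz hzj
    let u : ℂ × (Fin n → ℂ) → (Fin n → ℂ) := fun p => Function.update p.2 j p.1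
    have hu : Differentiable ℂ u := by
      rw [differentiable_pi]
      intro k
      by_cases h : k = j
      · subst h; simp only [u, Function.update_self]; fun_prop
      · simp only [u, Function.update_of_ne h]; fun_prop
    have hd := paramCircle (fun p : ℂ × (Fin n → ℂ) => (p.1 - p.2 j)⁻¹ • f (u p))
      ({p | p.1 - p.2 j ≠ 0} ∩ u ⁻¹' puncPoly (insert j S)) ?_ ?_ (1/2) z ?_
    · exact hd.const_smul (2 * Real.pi * Complex.I : ℂ)⁻¹
    · exact (isOpen_ne_fun (by fun_prop) (by fun_prop)).inter (hopen.preimage hu.continuous)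
    · rintro p ⟨hp1, hp2⟩
      refine DifferentiableAt.differentiableWithinAt ?_
      have hi : DifferentiableAt ℂ (fun p : ℂ × (Fin n → ℂ) => (p.1 - p.2 j)⁻¹) p :=
        DifferentiableAt.fun_inv (by fun_prop) hp1
      refine hi.fun_smul ?_
      exact ((hf _ hp2).differentiableAt (hopen.mem_nhds hp2)).comp p (hu p)
    · rintro ⟨w, x⟩ ⟨hw, hx⟩
      obtain rfl : x = z := hx
      have hw' : ‖w‖ = 1/2 := by
        have : ‖w‖ = |1/2| := by simpa using hw
        rw [this]; norm_num
      refine ⟨fun h => ?_, hupd x hz w ?_ (by rw [hw']; norm_num)⟩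
      · have : w = x j := sub_eq_zero.1 h
        rw [← this] at hzj; linarith
      · rintro rfl; norm_num at hw'
  classical
  let F : (Fin n → ℂ) → ℂ := fun z => if z j = 0 then G z else f z
  have hFf : EqOn F f (puncPoly (insert j S)) := fun z hz =>
    if_neg (hz.2 j (Finset.mem_insert_self _ _))
  refine ⟨F, ?_, hFf, ?_⟩
  · intro z hz
    refine DifferentiableAt.differentiableWithinAt ?_
    by_cases h : z j = 0
    · have hnear : ‖z j‖ < 1/2 := by rw [h]; norm_num
      refine (hGd z hz hnear).congr_of_eventuallyEq ?_
      have hn : ∀ᶠ x : Fin n → ℂ in 𝓝 z, ‖x j‖ < 1/2 :=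
        (isOpen_lt (by fun_prop) (by fun_prop)).mem_nhds hnear
      filter_upwards [hn, hopenS.mem_nhds hz] with x hx hxS
      by_cases hxj : x j = 0
      · simp [F, hxj]
      · simp only [F, if_neg hxj]; exact (hGf x hxS hxj hx).symm
    · have hm : z ∈ puncPoly (insert j S) := ⟨hz.1, fun k hk => by
        rcases Finset.mem_insert.1 hk with rfl | hk
        · exact h
        · exact hz.2 k hk⟩
      refine ((hf z hm).differentiableAt (hopen.mem_nhds hm)).congr_of_eventuallyEq ?_
      exact hFf.eventuallyEq_of_mem (hopen.mem_nhds hm)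
  · have h1 : IntegrableOn (fun z => ‖F z‖ ^ 2) (puncPoly (insert j S)) volume :=
      hL2.congr_fun (fun z hz => by simp only [hFf hz]) hopen.measurableSet
    refine h1.congr_set_ae ?_
    have hnull : volume {z : Fin n → ℂ | z j = 0} = 0 := by
      exact Measure.pi_hyperplane (fun _ => (volume : Measure ℂ)) j 0
    have hae : ∀ᵐ z : Fin n → ℂ, z j ≠ 0 := by
      rw [ae_iff]; simpa using hnull
    filter_upwards [hae] with z hz
    refine propext ⟨fun h => ⟨h.1, fun k hk => ?_⟩, fun h => ⟨h.1, fun k hk => h.2 k (Finset.mem_insert_of_mem hk)⟩⟩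
    rcases Finset.mem_insert.1 hk with rfl | hk
    · exact hz
    · exact h.2 k hk

theorem extAll {n : ℕ} (S : Finset (Fin n)) : ∀ (f : (Fin n → ℂ) → ℂ),
    DifferentiableOn ℂ f (puncPoly S) →
    IntegrableOn (fun z => ‖f z‖ ^ 2) (puncPoly S) volume →
    ∃ F : (Fin n → ℂ) → ℂ, DifferentiableOn ℂ F (puncPoly ∅) ∧ EqOn F f (puncPoly S) := by
  induction S using Finset.induction_on with
  | empty => exact fun f hf _ => ⟨f, hf, fun _ _ => rfl⟩
  | insert j S _ ih =>
    intro f hf hL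
    obtain ⟨F, hF, hFf, hFL⟩ := stepExt S j f hf hL
    obtain ⟨H, hH, hHF⟩ := ih F hF hFL
    refine ⟨H, hH, fun z hz => ?_⟩
    rw [hHF ⟨hz.1, fun k hk => hz.2 k (Finset.mem_insert_of_mem hk)⟩, hFf hz]

end L2Ext

/-- L² Riemann extension: a holomorphic function on the punctured polydisc
`Dⁿ \ {z₁⋯z_d = 0}` which is square-integrable extends holomorphically to `Dⁿ`. -/
theorem stmt14 (n d : ℕ) (hd1 : 1 ≤ d) (hdn : d ≤ n)
    (f : (Fin n → ℂ) → ℂ)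
    (P : Set (Fin n → ℂ)) (hP : P = {z | ∀ j, ‖z j‖ < 1})
    (Z : Set (Fin n → ℂ)) (hZ : Z = {z | ∃ j : Fin n, (j : ℕ) < d ∧ z j = 0})
    (hf : DifferentiableOn ℂ f (P \ Z))
    (hL2 : IntegrableOn (fun z => ‖f z‖ ^ 2) (P \ Z) volume) :
    ∃ F : (Fin n → ℂ) → ℂ, DifferentiableOn ℂ F P ∧ Set.EqOn F f (P \ Z) := by
  have h1 : P \ Z = L2Ext.puncPoly (Finset.univ.filter fun j : Fin n => (j : ℕ) < d) := by
    ext z; simp [hP, hZ, L2Ext.puncPoly]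
  have h2 : P = L2Ext.puncPoly ∅ := by
    ext z; simp [hP, L2Ext.puncPoly]
  rw [h1] at hf hL2 ⊢
  rw [h2]
  exact L2Ext.extAll _ f hf hL2
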